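/- Let P = {v_0, v_1, …, v_{n−1}} be a set of n ≥ 4 points in convex position in the plane, and let C_i and C_j be two edge-disjoint 1-plane Hamiltonian cycles on P, each of which has exactly two boundary edges. Then no boundary edge of C_i is consecutive along the convex hull with a boundary edge of C_j; that is, if v_r v_{r+1} is a boundary edge of C_i then neither v_{r−1} v_r nor v_{r+1} v_{r+2} is a boundary edge of C_j. -/

import Mathlib

open Finset

noncomputable section

/-- The Euclidean plane. -/
abbrev Pt : Type := EuclideanSpace ℝ (Fin 2)

/-- Strict counterclockwise orientation of an ordered triple of points. -/
def Ccw (p q r : Pt) : Prop :=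
  0 < (q 0 - p 0) * (r 1 - p 1) - (q 1 - p 1) * (r 0 - p 0)

/-- `v` lists `n` points in convex position, labeled counterclockwise. -/
def ConvexCcw {n : ℕ} (v : Fin n → Pt) : Prop :=
  ∀ i j k : Fin n, i < j → j < k → Ccw (v i) (v j) (v k)

/-- The open straight-line segment drawn for an unordered pair of indices. -/
def seg {n : ℕ} (v : Fin n → Pt) (e : Sym2 (Fin n)) : Set Pt :=
  Sym2.lift ⟨fun a b => openSegment ℝ (v a) (v b),
    fun a b => openSegment_symm ℝ (v a) (v b)⟩ e

/-- Two drawn edges cross: they share no endpoint and their open segments meet. -/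
def EdgesCross {n : ℕ} (v : Fin n → Pt) (e f : Sym2 (Fin n)) : Prop :=
  (∀ a, a ∈ e → a ∉ f) ∧ (seg v e ∩ seg v f).Nonempty

/-- A set of drawn edges is 1-plane: each edge is crossed by at most one other edge. -/
def OnePlane {n : ℕ} (v : Fin n → Pt) (E : Set (Sym2 (Fin n))) : Prop :=
  ∀ e ∈ E, {f | f ∈ E ∧ EdgesCross v e f}.Subsingleton

/-- `σ` is a Hamiltonian cycle on all `n` vertices. -/
def IsHamCycle {n : ℕ} (σ : Equiv.Perm (Fin n)) : Prop :=
  σ.IsCycle ∧ σ.support = Finset.univ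

/-- The edge set of the Hamiltonian cycle `σ`. -/
def cycEdges {n : ℕ} (σ : Equiv.Perm (Fin n)) : Set (Sym2 (Fin n)) :=
  {e | ∃ i : Fin n, e = s(i, σ i)}

/-- `σ` is a 1-plane Hamiltonian cycle for the point placement `v`. -/
def IsOnePlaneHC {n : ℕ} (v : Fin n → Pt) (σ : Equiv.Perm (Fin n)) : Prop :=
  IsHamCycle σ ∧ OnePlane v (cycEdges σ)

/-- `k` lies on the counterclockwise arc from `j` to `i` (inclusive), indices mod `n`. -/
def InArc {n : ℕ} (j i k : Fin n) : Prop := (k - j).val ≤ (i - j).val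

/-- Convex quadrilaterals: the two diagonals meet. -/
theorem Ccw.diagonals_meet {p q r s : Pt} (h₁ : Ccw p q r) (h₂ : Ccw q r s) (h₃ : Ccw r s p)
    (h₄ : Ccw s p q) : (openSegment ℝ p r ∩ openSegment ℝ q s).Nonempty := by
  unfold Ccw at *
  set δ := (q 0 - p 0) * (r 1 - p 1) - (q 1 - p 1) * (r 0 - p 0) with hδ
  set α := (r 0 - q 0) * (s 1 - q 1) - (r 1 - q 1) * (s 0 - q 0) with hα
  set β := (s 0 - r 0) * (p 1 - r 1) - (s 1 - r 1) * (p 0 - r 0) with hβ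
  set γ := (p 0 - s 0) * (q 1 - s 1) - (p 1 - s 1) * (q 0 - s 0) with hγ
  have hsum : α + γ = β + δ := by rw [hα, hβ, hγ, hδ]; ring
  have hpos : 0 < α + γ := by linarith
  have hne : α + γ ≠ 0 := hpos.ne'
  refine ⟨(α / (α + γ)) • p + (γ / (α + γ)) • r,
    ⟨α / (α + γ), γ / (α + γ), by positivity, by positivity, by field_simp, rfl⟩,
    ⟨β / (α + γ), δ / (α + γ), by positivity, by positivity, ?_, ?_⟩⟩
  · rw [← add_div, ← hsum, div_self hne]
  · ext i
    simp only [PiLp.add_apply, PiLp.smul_apply, smul_eq_mul]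
    rw [div_mul_eq_mul_div, div_mul_eq_mul_div, div_mul_eq_mul_div, div_mul_eq_mul_div,
      ← add_div, ← add_div]
    congr 1
    rw [hα, hβ, hγ, hδ]
    fin_cases i <;> simp <;> ring

theorem Ccw.rotate {p q r : Pt} (h : Ccw p q r) : Ccw q r p := by
  unfold Ccw at *
  linarith

/-- An edge relation on the integers, seen as the cyclically repeated vertices of a convex `n`-gon,
in which every vertex has two neighbours, every edge is crossed at most once, and at most two
boundary edges occur. -/
structure CyclicOnePlane (n : ℤ) (R : ℤ → ℤ → Prop) : Prop where
  symm : ∀ a b, R a b → R b a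
  add_period : ∀ a b, R a (b + n) ↔ R a b
  two_neighbours : ∀ a, ∃ b c, b ≠ c ∧ a < b ∧ b < a + n ∧ a < c ∧ c < a + n ∧ R a b ∧ R a c
  crossing_unique : ∀ a c b d d', a < b → b < c → c < d → d < a + n → c < d' → d' < a + n →
    R a c → R b d → R b d' → d = d'
  boundary_le_two : ∀ k l m, 0 ≤ k → k < l → l < m → m < n →
    R k (k + 1) → R l (l + 1) → R m (m + 1) → False

namespace CyclicOnePlane

variable {n : ℤ} {R : ℤ → ℤ → Prop}

/-- Each side of an edge contains a boundary edge. -/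
theorem exists_boundary (h : CyclicOnePlane n R) {x y : ℤ} (hxy : x < y) (hyn : y < x + n)
    (hR : R x y) : ∃ k, x ≤ k ∧ k < y ∧ R k (k + 1) := by
  induction hm : (y - x).toNat using Nat.strong_induction_on generalizing x y with
  | _ m ih =>
    have inner : ∀ b, x + 1 < b → b ≤ y → R (x + 1) b → ∃ k, x ≤ k ∧ k < y ∧ R k (k + 1) := by
      intro b hb hby hRb
      obtain ⟨k, hk, hkb, hRk⟩ := ih _ (by omega) hb (by omega) hRb rfl
      exact ⟨k, by omega, by omega, hRk⟩
    have wrap : R (x + 1) (x + n) → ∃ k, x ≤ k ∧ k < y ∧ R k (k + 1) := fun hRb =>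
      ⟨x, le_rfl, hxy, h.symm _ _ ((h.add_period _ _).1 hRb)⟩
    obtain rfl | hlt : y = x + 1 ∨ x + 1 < y := by omega
    · exact ⟨x, le_rfl, hxy, hR⟩
    obtain ⟨b, c, hbc, hb, hbn, hc, hcn, hRb, hRc⟩ := h.two_neighbours (x + 1)
    by_cases hby : b ≤ y
    · exact inner b hb hby hRb
    by_cases hcy : c ≤ y
    · exact inner c hc hcy hRc
    obtain rfl | hbx : b = x + n ∨ b < x + n := by omega
    · exact wrap hRb
    obtain rfl | hcx : c = x + n ∨ c < x + n := by omega
    · exact wrap hRc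
    exact absurd (h.crossing_unique x y (x + 1) b c (by omega) hlt (by omega) hbx (by omega) hcx
      hR hRb hRc) hbc

theorem edge_zero_two (h : CyclicOnePlane n R) (h01 : R 0 1) : R 0 2 := by
  obtain ⟨j, hj1, hjn, hRj⟩ : ∃ j, 1 < j ∧ j < n ∧ R 0 j := by
    obtain ⟨b, c, hbc, hb, hbn, hc, hcn, hRb, hRc⟩ := h.two_neighbours 0
    obtain hb1 | hc1 : 1 < b ∨ 1 < c := by omega
    · exact ⟨b, hb1, by omega, hRb⟩
    · exact ⟨c, hc1, by omega, hRc⟩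
  obtain rfl | hj : j = 2 ∨ 2 < j := by omega
  · exact hRj
  have hjn' : R j n := by
    have := (h.add_period j 0).2 (h.symm _ _ hRj)
    rwa [zero_add] at this
  obtain ⟨k', hk'j, hk'n, hRk'⟩ := h.exists_boundary hjn (by omega) hjn'
  have unique : ∀ k, 1 ≤ k → k < j → ¬ R k (k + 1) := fun k hk hkj hRk =>
    h.boundary_le_two 0 k k' le_rfl (by omega) (by omega) hk'n (by simpa using h01) hRk hRk'
  have far : ∀ b, 2 < b → b < 2 + n → R 2 b → R 0 2 ∨ (j < b ∧ b < 0 + n) := by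
    intro b hb hbn hRb
    by_cases hbj : b ≤ j
    · obtain ⟨k, hk, hkb, hRk⟩ := h.exists_boundary hb hbn hRb
      exact absurd hRk (unique k (by omega) (by omega))
    obtain rfl | rfl | hlt : b = 1 + n ∨ b = 0 + n ∨ b < 0 + n := by omega
    · exact absurd (h.symm _ _ ((h.add_period _ _).1 hRb)) (unique 1 le_rfl hj1)
    · exact Or.inl (h.symm _ _ ((h.add_period _ _).1 hRb))
    · exact Or.inr ⟨by omega, hlt⟩
  obtain ⟨b, c, hbc, hb, hbn, hc, hcn, hRb, hRc⟩ := h.two_neighbours 2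
  obtain h02 | ⟨hjb, hbn'⟩ := far b hb hbn hRb
  · exact h02
  obtain h02 | ⟨hjc, hcn'⟩ := far c hc hcn hRc
  · exact h02
  exact absurd (h.crossing_unique 0 j 2 b c two_pos hj hjb hbn' hjc hcn' hRj hRb hRc) hbc

end CyclicOnePlane

/-- The vertex index obtained by reducing an integer modulo `n`. -/
def cyc (n : ℕ) [NeZero n] (k : ℤ) : Fin n :=
  ⟨(k % n).toNat, by
    have hn : 0 < n := NeZero.pos n
    have := Int.emod_nonneg k (b := n) (by omega)
    have := Int.emod_lt_of_pos k (b := n) (by omega)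
    omega⟩

section cyc

variable {n : ℕ} [NeZero n]

theorem cyc_val (k : ℤ) : ((cyc n k).val : ℤ) = k % n :=
  Int.toNat_of_nonneg (Int.emod_nonneg k (by have := NeZero.pos n; omega))

theorem cyc_eq_iff {a b : ℤ} : cyc n a = cyc n b ↔ a % n = b % n := by
  rw [Fin.ext_iff, ← Int.natCast_inj, cyc_val, cyc_val]

theorem cyc_coe (c : Fin n) : cyc n c.val = c := by
  have : (((cyc n c.val).val : ℕ) : ℤ) = c.val := by
    rw [cyc_val, Int.emod_eq_of_lt] <;> omega
  exact Fin.ext (by omega)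

theorem cyc_add_period (k : ℤ) : cyc n (k + n) = cyc n k := by
  rw [cyc_eq_iff, Int.add_emod_right]

theorem cyc_sub_period (k : ℤ) : cyc n (k - n) = cyc n k := by
  rw [cyc_eq_iff, Int.sub_emod_right]

theorem cyc_add_one (hn : 4 ≤ n) (k : ℤ) : cyc n (k + 1) = cyc n k + 1 := by
  apply Fin.ext
  rw [← Int.natCast_inj, cyc_val, Fin.val_add, Fin.val_one', Nat.mod_eq_of_lt (by omega : 1 < n),
    Int.natCast_mod, Nat.cast_add, cyc_val]
  simp

theorem eq_of_cyc_eq {a b : ℤ} (h : cyc n a = cyc n b) (hab : a < b + n) (hba : b < a + n) :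
    a = b := by
  rw [cyc_eq_iff, Int.emod_eq_emod_iff_emod_sub_eq_zero] at h
  have := Int.eq_zero_of_abs_lt_dvd (Int.dvd_of_emod_eq_zero h) (abs_lt.2 ⟨by omega, by omega⟩)
  omega

theorem exists_cyc_eq (a : ℤ) (x : Fin n) (hx : x ≠ cyc n a) :
    ∃ b, a < b ∧ b < a + n ∧ cyc n b = x := by
  have hn : (0 : ℤ) < n := by have := NeZero.pos n; omega
  have h₀ := Int.emod_nonneg (x.val - a) hn.ne'
  have h₁ := Int.emod_lt_of_pos (x.val - a) hn
  have hb : cyc n (a + (x.val - a) % n) = x := by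
    conv_rhs => rw [← cyc_coe x]
    rw [cyc_eq_iff, Int.add_emod_emod]
    congr 1
    ring
  refine ⟨a + (x.val - a) % n, ?_, by omega, hb⟩
  by_contra hle
  have : a + (x.val - a) % n = a := by omega
  rw [this] at hb
  exact hx hb.symm

theorem ConvexCcw.ccw_cyc {v : Fin n → Pt} (hv : ConvexCcw v) {a b c : ℤ} (hab : a < b)
    (hbc : b < c) (hca : c < a + n) : Ccw (v (cyc n a)) (v (cyc n b)) (v (cyc n c)) := by
  have hn : (0 : ℤ) < n := by omega
  have hlin : ∀ {x y z : ℤ}, 0 ≤ x → x < y → y < z → z < n →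
      Ccw (v (cyc n x)) (v (cyc n y)) (v (cyc n z)) := by
    intro x y z hx hxy hyz hz
    have hval : ∀ k : ℤ, 0 ≤ k → k < n → ((cyc n k).val : ℤ) = k := fun k h₀ h₁ => by
      rw [cyc_val, Int.emod_eq_of_lt h₀ h₁]
    have := hval x hx (by omega)
    have := hval y (by omega) (by omega)
    have := hval z (by omega) hz
    exact hv _ _ _ (Fin.lt_def.2 (by omega)) (Fin.lt_def.2 (by omega))
  have hshift : ∀ k, cyc n (k - n * (a / n)) = cyc n k := fun k => by
    rw [cyc_eq_iff, Int.sub_mul_emod_self_left]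
  have h₀ := Int.emod_nonneg a hn.ne'
  have h₁ := Int.emod_lt_of_pos a hn
  rw [Int.emod_def] at h₀ h₁
  rw [← hshift a, ← hshift b, ← hshift c]
  generalize n * (a / n) = t at *
  by_cases hc : c - t < n
  · exact hlin h₀ (by omega) (by omega) hc
  rw [← cyc_sub_period (c - t)]
  by_cases hb : b - t < n
  · exact (hlin (x := c - t - n) (by omega) (by omega) (by omega) hb).rotate
  rw [← cyc_sub_period (b - t)]
  exact (hlin (x := b - t - n) (y := c - t - n) (z := a - t)
    (by omega) (by omega) (by omega) (by omega)).rotate.rotate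

theorem ConvexCcw.edgesCross_cyc {v : Fin n → Pt} (hv : ConvexCcw v) {a b c d : ℤ} (hab : a < b)
    (hbc : b < c) (hcd : c < d) (hda : d < a + n) :
    EdgesCross v s(cyc n a, cyc n c) s(cyc n b, cyc n d) := by
  have hne : ∀ {x y : ℤ}, x < y + n → y < x + n → x ≠ y → cyc n x ≠ cyc n y :=
    fun h₁ h₂ h h' => h (eq_of_cyc_eq h' h₁ h₂)
  refine ⟨?_, ?_⟩
  · intro x hx hx'
    rw [Sym2.mem_iff] at hx hx'
    rcases hx with rfl | rfl <;> rcases hx' with h | h <;>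
      exact hne (by omega) (by omega) (by omega) h
  · exact Ccw.diagonals_meet (hv.ccw_cyc hab hbc (by omega)) (hv.ccw_cyc hbc hcd (by omega))
      (hv.ccw_cyc (a := a) (b := c) (c := d) (by omega) hcd hda).rotate
      (hv.ccw_cyc (a := a) (b := b) (c := d) hab (by omega) hda).rotate.rotate

end cyc

theorem EdgesCross.symm {n : ℕ} {v : Fin n → Pt} {e f : Sym2 (Fin n)} (h : EdgesCross v e f) :
    EdgesCross v f e :=
  ⟨fun a hf he => h.1 a he hf, by rw [Set.inter_comm]; exact h.2⟩

theorem IsHamCycle.apply_ne {n : ℕ} {σ : Equiv.Perm (Fin n)} (hσ : IsHamCycle σ) (x : Fin n) :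
    σ x ≠ x :=
  Equiv.Perm.mem_support.1 (hσ.2 ▸ Finset.mem_univ x)

theorem IsHamCycle.apply_ne_symm_apply {n : ℕ} (hn : 4 ≤ n) {σ : Equiv.Perm (Fin n)}
    (hσ : IsHamCycle σ) (x : Fin n) : σ x ≠ σ.symm x := by
  intro h
  have h2 : (σ ^ 2) x = x := by rw [pow_two, Equiv.Perm.mul_apply, h, Equiv.apply_symm_apply]
  have hone : σ ^ 2 = 1 := hσ.1.pow_eq_one_iff.2 ⟨x, hσ.apply_ne x, h2⟩
  have hle := Nat.le_of_dvd two_pos (orderOf_dvd_of_pow_eq_one hone)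
  rw [hσ.1.orderOf, hσ.2, Finset.card_univ, Fintype.card_fin] at hle
  omega

section OnePlane

variable {n : ℕ} [NeZero n] {v : Fin n → Pt} {σ : Equiv.Perm (Fin n)}

theorem IsHamCycle.two_neighbours_cyc (hn : 4 ≤ n) (hσ : IsHamCycle σ) (a : ℤ) :
    ∃ b c, b ≠ c ∧ a < b ∧ b < a + n ∧ a < c ∧ c < a + n ∧
      s(cyc n a, cyc n b) ∈ cycEdges σ ∧ s(cyc n a, cyc n c) ∈ cycEdges σ := by
  have hsymm : σ.symm (cyc n a) ≠ cyc n a := fun h =>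
    hσ.apply_ne (cyc n a) ((Equiv.symm_apply_eq σ).1 h).symm
  obtain ⟨b, hab, hba, hb⟩ := exists_cyc_eq a _ (hσ.apply_ne (cyc n a))
  obtain ⟨c, hac, hca, hc⟩ := exists_cyc_eq a _ hsymm
  refine ⟨b, c, ?_, hab, hba, hac, hca, ⟨cyc n a, by rw [hb]⟩, ⟨cyc n c, ?_⟩⟩
  · rintro rfl
    exact hσ.apply_ne_symm_apply hn (cyc n a) (hb ▸ hc)
  · rw [hc, Equiv.apply_symm_apply, Sym2.eq_swap]

theorem OnePlane.crossing_unique_cyc (hv : ConvexCcw v) {E : Set (Sym2 (Fin n))}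
    (hE : OnePlane v E) {a b c d d' : ℤ} (hab : a < b) (hbc : b < c) (hcd : c < d)
    (hda : d < a + n) (hcd' : c < d') (hda' : d' < a + n) (hac : s(cyc n a, cyc n c) ∈ E)
    (hbd : s(cyc n b, cyc n d) ∈ E) (hbd' : s(cyc n b, cyc n d') ∈ E) : d = d' := by
  have h := hE _ hac ⟨hbd, hv.edgesCross_cyc hab hbc hcd hda⟩
    ⟨hbd', hv.edgesCross_cyc hab hbc hcd' hda'⟩
  exact eq_of_cyc_eq (Sym2.congr_right.1 h) (by omega) (by omega)

theorem boundary_le_two_cyc (hn : 4 ≤ n) {E : Set (Sym2 (Fin n))}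
    (htwo : ∃ r s : Fin n, r ≠ s ∧ ∀ k : Fin n, s(k, k + 1) ∈ E ↔ k = r ∨ k = s)
    {k l m : ℤ} (hkl : k < l) (hlm : l < m) (hmk : m < k + n)
    (hk : s(cyc n k, cyc n (k + 1)) ∈ E) (hl : s(cyc n l, cyc n (l + 1)) ∈ E)
    (hm : s(cyc n m, cyc n (m + 1)) ∈ E) : False := by
  obtain ⟨r, s, -, h⟩ := htwo
  rw [cyc_add_one hn, h] at hk hl hm
  have hne : ∀ {x y : ℤ}, x < y → y < x + n → cyc n x ≠ cyc n y :=
    fun h₁ h₂ h' => h₁.ne (eq_of_cyc_eq h' (by omega) h₂)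
  have h₁ := hne hkl (by omega)
  have h₂ := hne hlm (by omega)
  have h₃ := hne (hkl.trans hlm) hmk
  grind

theorem IsOnePlaneHC.cyclicOnePlane (hn : 4 ≤ n) (hv : ConvexCcw v) (hσ : IsOnePlaneHC v σ)
    (htwo : ∃ r s : Fin n, r ≠ s ∧ ∀ k : Fin n, s(k, k + 1) ∈ cycEdges σ ↔ k = r ∨ k = s)
    (t : ℤ) : CyclicOnePlane n fun a b => s(cyc n (t + a), cyc n (t + b)) ∈ cycEdges σ where
  symm a b h := by rwa [Sym2.eq_swap]
  add_period a b := by rw [← add_assoc, cyc_add_period]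
  two_neighbours a := by
    obtain ⟨b, c, hbc, hb, hbn, hc, hcn, hRb, hRc⟩ := hσ.1.two_neighbours_cyc hn (t + a)
    refine ⟨b - t, c - t, by omega, by omega, by omega, by omega, by omega, ?_, ?_⟩ <;>
      rwa [add_sub_cancel]
  crossing_unique a c b d d' hab hbc hcd hda hcd' hda' hac hbd hbd' := by
    have := hσ.2.crossing_unique_cyc hv (by omega) (by omega) (by omega) (by omega) (by omega)
      (by omega) hac hbd hbd'
    omega
  boundary_le_two k l m hk hkl hlm hm hRk hRl hRm := by
    rw [← add_assoc] at hRk hRl hRm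
    exact boundary_le_two_cyc hn htwo (by omega) (by omega) (by omega) hRk hRl hRm

theorem IsOnePlaneHC.cyclicOnePlane_reflect (hn : 4 ≤ n) (hv : ConvexCcw v)
    (hσ : IsOnePlaneHC v σ)
    (htwo : ∃ r s : Fin n, r ≠ s ∧ ∀ k : Fin n, s(k, k + 1) ∈ cycEdges σ ↔ k = r ∨ k = s)
    (t : ℤ) : CyclicOnePlane n fun a b => s(cyc n (t - a), cyc n (t - b)) ∈ cycEdges σ where
  symm a b h := by rwa [Sym2.eq_swap]
  add_period a b := by rw [← sub_sub, cyc_sub_period]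
  two_neighbours a := by
    obtain ⟨b, c, hbc, hb, hbn, hc, hcn, hRb, hRc⟩ := hσ.1.two_neighbours_cyc hn (t - a)
    refine ⟨t - b + n, t - c + n, by omega, by omega, by omega, by omega, by omega, ?_, ?_⟩
    · rwa [show t - (t - b + n) = b - n by ring, cyc_sub_period]
    · rwa [show t - (t - c + n) = c - n by ring, cyc_sub_period]
  crossing_unique a c b d d' hab hbc hcd hda hcd' hda' hac hbd hbd' := by
    rw [Sym2.eq_swap] at hac
    rw [← cyc_add_period (t - d)] at hbd
    rw [← cyc_add_period (t - d')] at hbd'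
    have := hσ.2.crossing_unique_cyc hv (by omega) (by omega) (by omega) (by omega) (by omega)
      (by omega) hac hbd hbd'
    omega
  boundary_le_two k l m hk hkl hlm hm hRk hRl hRm := by
    have key : ∀ x, s(cyc n (t - x), cyc n (t - (x + 1))) ∈ cycEdges σ →
        s(cyc n (t - (x + 1)), cyc n (t - (x + 1) + 1)) ∈ cycEdges σ := fun x hx => by
      rwa [Sym2.eq_swap, show t - (x + 1) + 1 = t - x by ring]
    exact boundary_le_two_cyc hn htwo (by omega) (by omega) (by omega) (key m hRm) (key l hRl)
      (key k hRk)

/-- Next to a boundary edge `v_r v_{r+1}` the cycle uses `v_r v_{r+2}`. -/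
theorem IsOnePlaneHC.edge_add_two (hn : 4 ≤ n) (hv : ConvexCcw v) (hσ : IsOnePlaneHC v σ)
    (htwo : ∃ r s : Fin n, r ≠ s ∧ ∀ k : Fin n, s(k, k + 1) ∈ cycEdges σ ↔ k = r ∨ k = s)
    {r : Fin n} (hr : s(r, r + 1) ∈ cycEdges σ) : s(r, r + 1 + 1) ∈ cycEdges σ := by
  have h := (hσ.cyclicOnePlane hn hv htwo r.val).edge_zero_two
  simp only [add_zero, show (r.val : ℤ) + 2 = r.val + 1 + 1 by ring, cyc_add_one hn, cyc_coe] at h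
  exact h hr

/-- Next to a boundary edge `v_{r+1} v_{r+2}` the cycle uses `v_r v_{r+2}`. -/
theorem IsOnePlaneHC.edge_sub_one (hn : 4 ≤ n) (hv : ConvexCcw v) (hσ : IsOnePlaneHC v σ)
    (htwo : ∃ r s : Fin n, r ≠ s ∧ ∀ k : Fin n, s(k, k + 1) ∈ cycEdges σ ↔ k = r ∨ k = s)
    {r : Fin n} (hr : s(r + 1, r + 1 + 1) ∈ cycEdges σ) : s(r, r + 1 + 1) ∈ cycEdges σ := by
  have h := (hσ.cyclicOnePlane_reflect hn hv htwo (r.val + 1 + 1)).edge_zero_two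
  rw [sub_zero, show (r.val : ℤ) + 1 + 1 - 1 = r.val + 1 by ring,
    show (r.val : ℤ) + 1 + 1 - 2 = r.val by ring, cyc_add_one hn, cyc_add_one hn, cyc_coe,
    Sym2.eq_swap] at h
  rw [Sym2.eq_swap]
  exact h hr

end OnePlane

/-- if `C_i` and `C_j` are edge-disjoint 1-plane Hamiltonian cycles
on `n ≥ 4` points in convex position, each with exactly two boundary edges, then
no boundary edge of `C_i` is consecutive (along the hull) with one of `C_j`. -/
theorem stmt6 {n : ℕ} [NeZero n] (hn : 4 ≤ n) (v : Fin n → Pt)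
    (hconv : ConvexCcw v) (σ₁ σ₂ : Equiv.Perm (Fin n))
    (hC₁ : IsOnePlaneHC v σ₁) (hC₂ : IsOnePlaneHC v σ₂)
    (hdisj : Disjoint (cycEdges σ₁) (cycEdges σ₂))
    (htwo₁ : ∃ r s : Fin n, r ≠ s ∧
      ∀ k : Fin n, s(k, k + 1) ∈ cycEdges σ₁ ↔ k = r ∨ k = s)
    (htwo₂ : ∃ r s : Fin n, r ≠ s ∧
      ∀ k : Fin n, s(k, k + 1) ∈ cycEdges σ₂ ↔ k = r ∨ k = s) :
    ∀ r : Fin n, s(r, r + 1) ∈ cycEdges σ₁ →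
      s(r - 1, r) ∉ cycEdges σ₂ ∧ s(r + 1, r + 1 + 1) ∉ cycEdges σ₂ := by
  intro r hr
  refine ⟨fun h => ?_, fun h => ?_⟩
  · obtain ⟨q, rfl⟩ : ∃ q : Fin n, r = q + 1 := ⟨r - 1, (sub_add_cancel r 1).symm⟩
    rw [add_sub_cancel_right] at h
    exact Set.disjoint_left.1 hdisj (hC₁.edge_sub_one hn hconv htwo₁ hr)
      (hC₂.edge_add_two hn hconv htwo₂ h)
  · exact Set.disjoint_left.1 hdisj (hC₁.edge_add_two hn hconv htwo₁ hr)
      (hC₂.edge_sub_one hn hconv htwo₂ h)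

end
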